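/- arXiv:2402.11285 — 6 statements merged into one kernel-verified Lean document; each statement's English description precedes it below -/
import Mathlib

section
/- Let T ≥ 1 and n ≥ 1, let Θ ⊆ ℝⁿ be a nonempty compact convex set, and let D > 0 satisfy ‖θ‖₂ ≤ D and ‖θ − θ'‖₂ ≤ D for all θ, θ' ∈ Θ. Let κ₁,…,κ_T ∈ ℝⁿ be loss (gradient) vectors and κ̃₁,…,κ̃_T ∈ ℝⁿ be their predictions. Set σ = 2√2/D and σ_{1:t} = σ·√(Σ_{τ=1}^t ‖κ_τ − κ̃_τ‖₂²). Suppose the iterates satisfy θ₁ ∈ argmin_{θ∈Θ} ⟨θ, κ̃₁⟩ and, for each 1 ≤ t ≤ T−1, θ_{t+1} ∈ argmin_{θ∈Θ} { (σ_{1:t}/2)·‖θ‖₂² + ⟨θ, Σ_{τ=1}^t κ_τ + κ̃_{t+1}⟩ }. Then for every θ ∈ Θ, the regret satisfies Σ_{t=1}^T ⟨κ_t, θ_t − θ⟩ ≤ 4√2 · D · √(Σ_{t=1}^T ‖κ_t − κ̃_t‖₂²). In particular, the regret is O(1) when all predictions are exact. -/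
open scoped InnerProductSpace

/-- A minimizer over a convex set of a linear functional plus `a / 2 * ‖·‖ ^ 2` satisfies the
quadratic growth inequality. -/
theorem quadratic_growth_of_forall_le {E : Type*} [NormedAddCommGroup E] [InnerProductSpace ℝ E]
    {s : Set E} (hs : Convex ℝ s) {a : ℝ} (ha : 0 ≤ a) {v x y : E} (hx : x ∈ s) (hy : y ∈ s)
    (hmin : ∀ z ∈ s, a / 2 * ‖x‖ ^ 2 + ⟪x, v⟫_ℝ ≤ a / 2 * ‖z‖ ^ 2 + ⟪z, v⟫_ℝ) :
    a / 2 * ‖x‖ ^ 2 + ⟪x, v⟫_ℝ + a / 2 * ‖y - x‖ ^ 2 ≤ a / 2 * ‖y‖ ^ 2 + ⟪y, v⟫_ℝ := by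
  obtain ⟨d, rfl⟩ : ∃ d, y = x + d := ⟨y - x, by abel⟩
  have expand (r : ℝ) : a / 2 * ‖x + r • d‖ ^ 2 + ⟪x + r • d, v⟫_ℝ =
      a / 2 * ‖x‖ ^ 2 + ⟪x, v⟫_ℝ + r * (a * ⟪x, d⟫_ℝ + ⟪d, v⟫_ℝ)
        + r ^ 2 * (a / 2 * ‖d‖ ^ 2) := by
    rw [norm_add_sq_real, inner_add_left, real_inner_smul_left, real_inner_smul_right, norm_smul,
      mul_pow, Real.norm_eq_abs, sq_abs]
    ring
  have hk : 0 ≤ a / 2 * ‖d‖ ^ 2 := by positivity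
  have hfirst : 0 ≤ a * ⟪x, d⟫_ℝ + ⟪d, v⟫_ℝ := by
    set c := a * ⟪x, d⟫_ℝ + ⟪d, v⟫_ℝ
    set k := a / 2 * ‖d‖ ^ 2
    by_contra! hc
    have hkc : 0 < k - c := by linarith
    set r := -c / (k - c) / 2 with hr
    have hr0 : 0 < r := by rw [hr]; have := neg_pos.2 hc; positivity
    have hrk : r * (k - c) = -c / 2 := by rw [hr]; field_simp
    have hr1 : r ≤ 1 := by nlinarith
    have hmem : x + r • d ∈ s := by
      simpa using hs.add_smul_sub_mem hx hy ⟨hr0.le, hr1⟩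
    have h := hmin _ hmem
    rw [expand] at h
    have h' : 0 ≤ r * (c + r * k) := by linarith
    have := nonneg_of_mul_nonneg_right h' hr0
    nlinarith
  have h := expand 1
  rw [one_smul] at h
  rw [h, add_sub_cancel_left]
  linarith

/-- Bound on the stability term of a step with prediction error `e` after cumulative error `A`. -/
theorem mul_sub_sq_le_sqrt_sub {D A e r : ℝ} (hD : 0 < D) (hA : 0 ≤ A) (he : 0 ≤ e)
    (hrD : r ≤ D) :
    r * e - √2 / D * A * r ^ 2 ≤ 3 * √2 * D * (√(A ^ 2 + e ^ 2) - A) := by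
  have h2 : 1 ≤ √2 := Real.one_le_sqrt.2 (by norm_num)
  have hgrow : A ≤ √(A ^ 2 + e ^ 2) := Real.le_sqrt_of_sq_le (by nlinarith)
  suffices h : r * e - 1 / D * A * r ^ 2 ≤ 3 * D * (√(A ^ 2 + e ^ 2) - A) by
    have h₁ : 1 / D * A * r ^ 2 ≤ √2 / D * A * r ^ 2 := by gcongr
    have h₂ : 3 * 1 * D * (√(A ^ 2 + e ^ 2) - A) ≤ 3 * √2 * D * (√(A ^ 2 + e ^ 2) - A) := by
      have := sub_nonneg.2 hgrow
      gcongr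
    linarith
  rcases le_or_gt A e with hAe | hAe
  · have h₁ : A + e / 3 ≤ √(A ^ 2 + e ^ 2) := Real.le_sqrt_of_sq_le (by nlinarith)
    have h₂ : r * e ≤ D * e := by gcongr
    have h₃ : 0 ≤ 1 / D * A * r ^ 2 := by positivity
    nlinarith
  · have hA' : 0 < A := he.trans_lt hAe
    have h₁ : A + e ^ 2 / A / 3 ≤ √(A ^ 2 + e ^ 2) := by
      have hq : e ^ 2 / A * A = e ^ 2 := div_mul_cancel₀ _ hA'.ne'
      have hqA : e ^ 2 / A ≤ A := by rw [div_le_iff₀ hA']; nlinarith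
      have hq0 : 0 ≤ e ^ 2 / A := by positivity
      exact Real.le_sqrt_of_sq_le (by nlinarith)
    have h₂ : r * e - 1 / D * A * r ^ 2 ≤ D * (e ^ 2 / A) := by
      have hsq : D * (e ^ 2 / A) - (r * e - 1 / D * A * r ^ 2) =
          ((D * e - A * r / 2) ^ 2 + 3 / 4 * (A * r) ^ 2) / (D * A) := by
        field_simp
        ring
      have : 0 ≤ ((D * e - A * r / 2) ^ 2 + 3 / 4 * (A * r) ^ 2) / (D * A) := by positivity
      linarith
    nlinarith

/-- Optimistic FTRL with adaptive quadratic regularizer: regret bound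
`∑ ⟨κ_t, θ_t − θ⟩ ≤ 4√2 · D · √(∑ ‖κ_t − κ̃_t‖²)`.
Indices are 0-based: slots are `0, …, T−1`. -/
theorem oftrl_quadratic_regret
    (T n : ℕ) (hT : 1 ≤ T) (hn : 1 ≤ n)
    (Θ : Set (EuclideanSpace ℝ (Fin n)))
    (hΘne : Θ.Nonempty) (hΘcomp : IsCompact Θ) (hΘconv : Convex ℝ Θ)
    (D : ℝ) (hD : 0 < D)
    (hbound : ∀ θ ∈ Θ, ‖θ‖ ≤ D)
    (hdiam : ∀ θ ∈ Θ, ∀ θ' ∈ Θ, ‖θ - θ'‖ ≤ D)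
    (κ κpred : ℕ → EuclideanSpace ℝ (Fin n))
    (θs : ℕ → EuclideanSpace ℝ (Fin n))
    (σ : ℝ) (hσ : σ = 2 * Real.sqrt 2 / D)
    (σ1 : ℕ → ℝ)
    (hσ1 : ∀ t, σ1 t = σ * Real.sqrt (∑ τ ∈ Finset.range t, ‖κ τ - κpred τ‖ ^ 2))
    (hinit : θs 0 ∈ Θ ∧ ∀ θ ∈ Θ, ⟪θs 0, κpred 0⟫_ℝ ≤ ⟪θ, κpred 0⟫_ℝ)
    (hupdate : ∀ t, 1 ≤ t → t ≤ T - 1 →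
      θs t ∈ Θ ∧ ∀ θ ∈ Θ,
        σ1 t / 2 * ‖θs t‖ ^ 2 + ⟪θs t, (∑ τ ∈ Finset.range t, κ τ) + κpred t⟫_ℝ ≤
        σ1 t / 2 * ‖θ‖ ^ 2 + ⟪θ, (∑ τ ∈ Finset.range t, κ τ) + κpred t⟫_ℝ) :
    ∀ θ ∈ Θ,
      ∑ t ∈ Finset.range T, ⟪κ t, θs t - θ⟫_ℝ ≤
        4 * Real.sqrt 2 * D * Real.sqrt (∑ t ∈ Finset.range T, ‖κ t - κpred t‖ ^ 2) := by
  intro θ hθ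
  set A : ℕ → ℝ := fun t => √(∑ τ ∈ Finset.range t, ‖κ τ - κpred τ‖ ^ 2) with hA
  have hσA (t : ℕ) : σ1 t / 2 = √2 / D * A t := by
    rw [hσ1, hσ]
    ring
  have hA0 (t : ℕ) : 0 ≤ A t := Real.sqrt_nonneg _
  have hAsucc (t : ℕ) : A (t + 1) = √(A t ^ 2 + ‖κ t - κpred t‖ ^ 2) := by
    simp only [hA]
    rw [Real.sq_sqrt (by positivity), Finset.sum_range_succ]
  have hσ0 (t : ℕ) : 0 ≤ σ1 t := by
    have h := hσA t
    have : 0 ≤ √2 / D * A t := mul_nonneg (by positivity) (hA0 t)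
    linarith
  have hσmono (t : ℕ) : σ1 t / 2 ≤ σ1 (t + 1) / 2 := by
    rw [hσA, hσA]
    have : A t ≤ A (t + 1) := by
      rw [hAsucc]
      exact Real.le_sqrt_of_sq_le (by nlinarith [sq_nonneg ‖κ t - κpred t‖])
    gcongr
  have hstep (t : ℕ) (ht : t < T) : θs t ∈ Θ ∧ ∀ z ∈ Θ,
      σ1 t / 2 * ‖θs t‖ ^ 2 + ⟪θs t, (∑ τ ∈ Finset.range t, κ τ) + κpred t⟫_ℝ ≤
        σ1 t / 2 * ‖z‖ ^ 2 + ⟪z, (∑ τ ∈ Finset.range t, κ τ) + κpred t⟫_ℝ := by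
    rcases Nat.eq_zero_or_pos t with rfl | h
    · simpa [hσ1] using hinit
    · exact hupdate t h (by omega)
  have key (t : ℕ) (ht : t ≤ T) : ∀ y ∈ Θ,
      ∑ τ ∈ Finset.range t, ⟪κ τ, θs τ⟫_ℝ - 3 * √2 * D * A t ≤
        σ1 t / 2 * ‖y‖ ^ 2 + ⟪y, ∑ τ ∈ Finset.range t, κ τ⟫_ℝ := by
    induction t with
    | zero => simp [hσ1, hA]
    | succ t ih =>
      intro y hy
      obtain ⟨hmem, hmin⟩ := hstep t ht
      have hprev := ih (by omega) _ hmem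
      have hgrowth := quadratic_growth_of_forall_le hΘconv (hσ0 t) hmem hy hmin
      have hstab := mul_sub_sq_le_sqrt_sub hD (hA0 t) (norm_nonneg (κ t - κpred t))
        (hdiam y hy _ hmem)
      rw [← hAsucc, ← hσA] at hstab
      have hcs := neg_le_of_abs_le (abs_real_inner_le_norm (y - θs t) (κ t - κpred t))
      have hreg := mul_le_mul_of_nonneg_right (hσmono t) (sq_nonneg ‖y‖)
      rw [Finset.sum_range_succ, Finset.sum_range_succ, inner_add_right,
        real_inner_comm (θs t) (κ t)]
      simp only [inner_add_right, inner_sub_left, inner_sub_right] at hgrowth hcs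
      linarith
  have hfinal := key T le_rfl θ hθ
  have hreg : σ1 T / 2 * ‖θ‖ ^ 2 ≤ √2 * D * A T := by
    calc σ1 T / 2 * ‖θ‖ ^ 2 ≤ σ1 T / 2 * D ^ 2 := by
          have := hσ0 T
          have := hbound θ hθ
          gcongr
      _ = √2 * D * A T := by
          rw [hσA]
          field_simp
  simp only [inner_sub_right, Finset.sum_sub_distrib]
  rw [← sum_inner, real_inner_comm]
  linarith
end

section
/- Let I ≥ 1, J ≥ 2 and T ≥ 1. Let c₁,…,c_T ∈ ℝ^{I×J} be reward (gradient) matrices and c̃₁,…,c̃_T ∈ ℝ^{I×J} be their predictions. Set η = min{ 1/2, √(2√2 / log J) } and η_{1:t} = η·√(Σ_{τ=1}^t ‖c_τ − c̃_τ‖_∞²), and define the entropic regularizer r_{1:t}(x) = (η_{1:t}/2)·( I·log J + Σ_{i,j} x_{ij}·log x_{ij} ) on the multi-simplex 𝒳. Suppose the iterates satisfy x₁ ∈ argmin_{x∈𝒳} ( −⟨x, c̃₁⟩ ) and, for each 1 ≤ t ≤ T−1, x_{t+1} ∈ argmin_{x∈𝒳} { r_{1:t}(x) − ⟨x, Σ_{τ=1}^t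 c_τ + c̃_{t+1}⟩ }. Then for every x ∈ 𝒳, the regret satisfies Σ_{t=1}^T ⟨c_t, x − x_t⟩ ≤ ( 4√2·I/η + η·I·log J ) · √(Σ_{t=1}^T ‖c_t − c̃_t‖_∞²). In particular, the regret is O(1) when all predictions are exact and O(√T) in the worst case. -/
/-- The multi-simplex: matrices with nonnegative entries whose rows each sum to 1. -/
def multiSimplex (I J : ℕ) : Set (Fin I → Fin J → ℝ) :=
  {x | (∀ i j, 0 ≤ x i j) ∧ ∀ i, ∑ j, x i j = 1}

/-- Frobenius inner product `⟨a, b⟩ = ∑_{i,j} a_{ij} b_{ij}` on `ℝ^{I×J}`. -/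
def matInner {I J : ℕ} (a b : Fin I → Fin J → ℝ) : ℝ :=
  ∑ i, ∑ j, a i j * b i j

/-- The map `s ↦ (1 + s) log (1 + s) + (1 - s) log (1 - s)` dominates `s ^ 2` on `[0, 1]`. -/
theorem sq_le_one_add_mul_log_add_one_sub_mul_log {s : ℝ} (hs : 0 ≤ s) (hs1 : s ≤ 1) :
    s ^ 2 ≤ (1 + s) * Real.log (1 + s) + (1 - s) * Real.log (1 - s) := by
  let φ : ℝ → ℝ := fun s => (1 + s) * Real.log (1 + s) + (1 - s) * Real.log (1 - s) - s ^ 2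
  have hcont : Continuous φ := by
    have h1 : Continuous fun s : ℝ => (1 + s) * Real.log (1 + s) :=
      Real.continuous_mul_log.comp (by fun_prop : Continuous fun s : ℝ => 1 + s)
    have h2 : Continuous fun s : ℝ => (1 - s) * Real.log (1 - s) :=
      Real.continuous_mul_log.comp (by fun_prop : Continuous fun s : ℝ => 1 - s)
    exact (h1.add h2).sub (by fun_prop)
  have hderiv : ∀ u ∈ Set.Ioo (0 : ℝ) 1,
      HasDerivAt φ (Real.log (1 + u) - Real.log (1 - u) - 2 * u) u := by
    rintro u ⟨hu0, hu1⟩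
    have h1 := (Real.hasDerivAt_mul_log (x := 1 + u) (by linarith)).comp u
      ((hasDerivAt_id u).const_add 1)
    have h2 := (Real.hasDerivAt_mul_log (x := 1 - u) (by linarith)).comp u
      ((hasDerivAt_id u).const_sub 1)
    refine ((h1.add h2).sub (hasDerivAt_pow 2 u)).congr_deriv ?_
    norm_num
    ring
  have hmono : MonotoneOn φ (Set.Icc 0 1) := by
    apply monotoneOn_of_deriv_nonneg (convex_Icc 0 1) hcont.continuousOn
    · rw [interior_Icc]
      exact fun u hu => (hderiv u hu).differentiableAt.differentiableWithinAt
    · rw [interior_Icc]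
      intro u hu
      rw [(hderiv u hu).deriv]
      obtain ⟨hu0, hu1⟩ := hu
      have h1 := Real.le_log_one_add_of_nonneg hu0.le
      have hpos : 0 < 1 - u := by linarith
      have h2 := Real.le_log_one_add_of_nonneg (x := u / (1 - u)) (by positivity)
      have e1 : 1 + u / (1 - u) = (1 - u)⁻¹ := by field_simp; ring
      have h2u : 0 < 2 - u := by linarith
      have e2 : 2 * (u / (1 - u)) / (u / (1 - u) + 2) = 2 * u / (2 - u) := by
        have e3 : u / (1 - u) + 2 = (2 - u) / (1 - u) := by field_simp; ring
        rw [e3]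
        field_simp
      rw [e1, e2, Real.log_inv] at h2
      have h3 : 2 * u ≤ 2 * u / (u + 2) + 2 * u / (2 - u) := by
        rw [div_add_div _ _ (by linarith) h2u.ne', le_div_iff₀ (by positivity)]
        nlinarith [pow_pos hu0 3]
      linarith
  have h := hmono (Set.left_mem_Icc.2 zero_le_one) ⟨hs, hs1⟩ hs
  simp only [φ] at h
  norm_num at h
  linarith

/-- The midpoint convexity gap of `x ↦ x log x`. -/
noncomputable def mulLogGap (x z : ℝ) : ℝ :=
  (x * Real.log x + z * Real.log z) / 2 - (x + z) / 2 * Real.log ((x + z) / 2)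

/-- Local strong convexity of `x ↦ x log x` at midpoints. -/
theorem sq_sub_le_mul_mulLogGap {x z : ℝ} (hx : 0 ≤ x) (hz : 0 ≤ z) :
    (x - z) ^ 2 ≤ 4 * (x + z) * mulLogGap x z := by
  wlog hzx : z ≤ x generalizing x z
  · have h := this hz hx (le_of_not_ge hzx)
    have hsymm : mulLogGap z x = mulLogGap x z := by
      unfold mulLogGap
      rw [add_comm z x, add_comm (z * _)]
    rw [hsymm] at h
    linarith
  rcases hx.eq_or_lt with rfl | hx
  · obtain rfl : z = 0 := le_antisymm hzx hz
    simp
  obtain ⟨m, hm⟩ : ∃ m, m = (x + z) / 2 := ⟨_, rfl⟩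
  have hmpos : 0 < m := by linarith
  obtain ⟨s, hsdef⟩ : ∃ s, s = (x - z) / (2 * m) := ⟨_, rfl⟩
  have hms : m * s = (x - z) / 2 := by rw [hsdef]; field_simp
  have hs0 : 0 ≤ s := by rw [hsdef]; exact div_nonneg (by linarith) (by linarith)
  have hs1 : s ≤ 1 := by
    rw [hsdef, div_le_one (by linarith)]
    linarith
  have hxe : x = m * (1 + s) := by linarith
  have hze : z = m * (1 - s) := by linarith
  have hlx : x * Real.log x = x * Real.log m + m * ((1 + s) * Real.log (1 + s)) := by
    rw [hxe, Real.log_mul hmpos.ne' (by linarith)]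
    ring
  have hlz : z * Real.log z = z * Real.log m + m * ((1 - s) * Real.log (1 - s)) := by
    rcases hs1.eq_or_lt with rfl | hlt
    · simp [hze]
    · rw [hze, Real.log_mul hmpos.ne' (by linarith)]
      ring
  have hgap : mulLogGap x z =
      m / 2 * ((1 + s) * Real.log (1 + s) + (1 - s) * Real.log (1 - s)) := by
    unfold mulLogGap
    rw [hlx, hlz, ← hm]
    linear_combination (-Real.log m) * hm
  have hkey := sq_le_one_add_mul_log_add_one_sub_mul_log hs0 hs1
  have h2 : m / 2 * s ^ 2 ≤ mulLogGap x z := by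
    rw [hgap]
    exact mul_le_mul_of_nonneg_left hkey (by linarith)
  have h3 := mul_le_mul_of_nonneg_left h2 (by linarith : 0 ≤ 8 * m)
  have e1 : (x - z) ^ 2 = 8 * m * (m / 2 * s ^ 2) := by
    linear_combination (-2 * (m * s) - (x - z)) * (2 * hms)
  have e2 : 4 * (x + z) = 8 * m := by linarith
  rw [e1, e2]
  exact h3

/-- A linear perturbation is absorbed by the convexity gap, up to the stability error `δ`. -/
theorem mul_sub_le_add_mulLogGap {x z g D w δ : ℝ} (hx : 0 ≤ x) (hz : 0 ≤ z)
    (hg : |g| ≤ D) (hw : 0 ≤ w) (hδ : 2 * D ≤ δ ∨ 0 < w ∧ 2 * D ^ 2 ≤ w * δ) :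
    g * (z - x) ≤ (x + z) / 2 * δ + w * mulLogGap x z := by
  have hD : 0 ≤ D := (abs_nonneg g).trans hg
  have hgap := sq_sub_le_mul_mulLogGap hx hz
  rcases (add_nonneg hx hz).eq_or_lt with h0 | hpos
  · obtain rfl : x = 0 := by linarith
    obtain rfl : z = 0 := by linarith
    simp [mulLogGap]
  have hgap0 : 0 ≤ mulLogGap x z := by
    by_contra! h
    nlinarith [sq_nonneg (x - z)]
  have hlin : g * (z - x) ≤ D * |z - x| := by
    calc g * (z - x) ≤ |g * (z - x)| := le_abs_self _
      _ = |g| * |z - x| := abs_mul _ _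
      _ ≤ D * |z - x| := by gcongr
  refine hlin.trans ?_
  rcases hδ with hδ | ⟨hwpos, hδ⟩
  · have h1 : |z - x| ≤ x + z := abs_le.2 ⟨by linarith, by linarith⟩
    nlinarith [mul_le_mul_of_nonneg_left h1 hD, mul_nonneg hw hgap0]
  · have hsq : |z - x| ^ 2 = (x - z) ^ 2 := by rw [sq_abs]; ring
    rw [← hsq] at hgap
    have h1 := mul_le_mul_of_nonneg_left hgap (sq_nonneg w)
    have h2 := mul_le_mul_of_nonneg_left hδ (sq_nonneg (x + z))
    have hwx : 0 < 4 * w * (x + z) := by positivity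
    refine le_of_mul_le_mul_left ?_ hwx
    nlinarith [sq_nonneg (2 * (x + z) * D - w * |z - x|)]

/-- The increment of the adaptive step size dominates the stability error of one round. -/
theorem stability_increment {D S S' η : ℝ} (hD : 0 ≤ D) (hS : 0 ≤ S) (hS' : 0 ≤ S')
    (hsq : S' ^ 2 = S ^ 2 + D ^ 2) (hη : 0 < η) (hη2 : η ≤ 1 / 2) :
    2 * D ≤ 4 * Real.sqrt 2 / η * (S' - S) ∨
      0 < η * S ∧ 2 * D ^ 2 ≤ η * S * (4 * Real.sqrt 2 / η * (S' - S)) := by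
  have hr : (1.4 : ℝ) ≤ Real.sqrt 2 := Real.le_sqrt_of_sq_le (by norm_num)
  have hSS : S ≤ S' := by nlinarith
  have hprod : (S' - S) * (S' + S) = D ^ 2 := by linarith [hsq]
  rcases le_or_gt S (2 * D) with h | h
  · left
    have h1 : (11.2 : ℝ) ≤ 4 * Real.sqrt 2 / η := by
      rw [le_div_iff₀ hη]
      nlinarith
    have h2 : S' + S ≤ 5 * D := by nlinarith
    have h3 : D ≤ 5 * (S' - S) := by
      rcases hD.eq_or_lt with rfl | hDpos
      · linarith
      · nlinarith [mul_le_mul_of_nonneg_left h2 (sub_nonneg.2 hSS)]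
    nlinarith [mul_le_mul_of_nonneg_right h1 (sub_nonneg.2 hSS)]
  · right
    have hSpos : 0 < S := by linarith
    refine ⟨by positivity, ?_⟩
    have e : η * S * (4 * Real.sqrt 2 / η * (S' - S)) = 4 * Real.sqrt 2 * (S * (S' - S)) := by
      field_simp
    rw [e]
    have h1 : S' + S ≤ 2.5 * S := by nlinarith
    have h2 : D ^ 2 ≤ 2.5 * (S * (S' - S)) := by
      nlinarith [mul_le_mul_of_nonneg_left h1 (sub_nonneg.2 hSS)]
    nlinarith [mul_nonneg hSpos.le (sub_nonneg.2 hSS)]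

/-- The shifted negative entropy `I log J + ∑ x log x` is nonnegative on the multi-simplex. -/
theorem entropy_nonneg {I J : ℕ} (hJ : 1 ≤ J) {x : Fin I → Fin J → ℝ}
    (hx : x ∈ multiSimplex I J) :
    0 ≤ I * Real.log J + ∑ i, ∑ j, x i j * Real.log (x i j) := by
  have hJpos : (0 : ℝ) < J := by exact_mod_cast hJ
  have helt : ∀ i j, x i j * (1 - Real.log J) - (J : ℝ)⁻¹ ≤ x i j * Real.log (x i j) := by
    intro i j
    rcases (hx.1 i j).eq_or_lt with h0 | hpos
    · rw [← h0]
      simp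
    · have h1 := Real.one_sub_inv_le_log_of_pos (mul_pos hpos hJpos)
      rw [Real.log_mul hpos.ne' hJpos.ne'] at h1
      have h2 := mul_le_mul_of_nonneg_left h1 hpos.le
      have h3 : x i j * (1 - (x i j * J)⁻¹) = x i j - (J : ℝ)⁻¹ := by field_simp
      rw [h3] at h2
      linarith
  have hrow : ∀ i, -Real.log J ≤ ∑ j, x i j * Real.log (x i j) := by
    intro i
    have h := Finset.sum_le_sum fun j (_ : j ∈ Finset.univ) => helt i j
    rw [Finset.sum_sub_distrib, ← Finset.sum_mul, hx.2 i] at h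
    simp [hJpos.ne'] at h
    linarith
  have h := Finset.sum_le_sum fun i (_ : i ∈ Finset.univ) => hrow i
  simp at h
  linarith

theorem sum_mul_log_nonpos {I J : ℕ} {x : Fin I → Fin J → ℝ} (hx : x ∈ multiSimplex I J) :
    ∑ i, ∑ j, x i j * Real.log (x i j) ≤ 0 := by
  refine Finset.sum_nonpos fun i _ => Finset.sum_nonpos fun j _ => ?_
  refine Real.mul_log_nonpos (hx.1 i j) ?_
  rw [← hx.2 i]
  exact Finset.single_le_sum (fun k _ => hx.1 i k) (Finset.mem_univ j)

theorem midpoint_mem_multiSimplex {I J : ℕ} {x z : Fin I → Fin J → ℝ}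
    (hx : x ∈ multiSimplex I J) (hz : z ∈ multiSimplex I J) :
    (fun i j => (x i j + z i j) / 2) ∈ multiSimplex I J := by
  refine ⟨fun i j => by linarith [hx.1 i j, hz.1 i j], fun i => ?_⟩
  rw [← Finset.sum_div, Finset.sum_add_distrib, hx.2 i, hz.2 i]
  norm_num

theorem matInner_add_right {I J : ℕ} (a b c : Fin I → Fin J → ℝ) :
    matInner a (b + c) = matInner a b + matInner a c := by
  simp [matInner, mul_add, Finset.sum_add_distrib]

theorem matInner_sub_right {I J : ℕ} (a b c : Fin I → Fin J → ℝ) :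
    matInner a (b - c) = matInner a b - matInner a c := by
  simp [matInner, mul_sub, Finset.sum_sub_distrib]

theorem matInner_comm {I J : ℕ} (a b : Fin I → Fin J → ℝ) : matInner a b = matInner b a := by
  simp [matInner, mul_comm]

theorem matInner_midpoint {I J : ℕ} (x z b : Fin I → Fin J → ℝ) :
    matInner (fun i j => (x i j + z i j) / 2) b = (matInner x b + matInner z b) / 2 := by
  simp only [matInner, ← Finset.sum_add_distrib, Finset.sum_div]
  exact Finset.sum_congr rfl fun i _ => Finset.sum_congr rfl fun j _ => by ring

/-- Stability of entropic minimizers: moving away from the minimizer `x` of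
`w / 2 * (K + ∑ x log x) - ⟨x, L⟩` gains at most `I * δ` against a perturbation `g`. -/
theorem entropic_minimizer_stability {I J : ℕ} {w K D δ : ℝ} {L g x z : Fin I → Fin J → ℝ}
    (hw : 0 ≤ w) (hx : x ∈ multiSimplex I J) (hz : z ∈ multiSimplex I J)
    (hmin : ∀ y ∈ multiSimplex I J,
      w / 2 * (K + ∑ i, ∑ j, x i j * Real.log (x i j)) - matInner x L ≤
        w / 2 * (K + ∑ i, ∑ j, y i j * Real.log (y i j)) - matInner y L)
    (hg : ∀ i j, |g i j| ≤ D) (hδ : 2 * D ≤ δ ∨ 0 < w ∧ 2 * D ^ 2 ≤ w * δ) :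
    w / 2 * (K + ∑ i, ∑ j, x i j * Real.log (x i j)) - matInner x L + matInner g (z - x) ≤
      w / 2 * (K + ∑ i, ∑ j, z i j * Real.log (z i j)) - matInner z L + I * δ := by
  have hmid := hmin _ (midpoint_mem_multiSimplex hx hz)
  rw [matInner_midpoint] at hmid
  have hgap : ∑ i, ∑ j, mulLogGap (x i j) (z i j) =
      (∑ i, ∑ j, x i j * Real.log (x i j) + ∑ i, ∑ j, z i j * Real.log (z i j)) / 2 -
        ∑ i, ∑ j, (x i j + z i j) / 2 * Real.log ((x i j + z i j) / 2) := by
    simp only [mulLogGap, ← Finset.sum_add_distrib, Finset.sum_div, Finset.sum_sub_distrib]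
  have hsum : matInner g (z - x) ≤ I * δ + w * ∑ i, ∑ j, mulLogGap (x i j) (z i j) := by
    have hle := Finset.sum_le_sum fun i (_ : i ∈ Finset.univ) =>
      Finset.sum_le_sum fun j (_ : j ∈ Finset.univ) =>
        mul_sub_le_add_mulLogGap (hx.1 i j) (hz.1 i j) (hg i j) hw hδ
    have hrow : ∀ i, ∑ j, (x i j + z i j) / 2 = 1 := (midpoint_mem_multiSimplex hx hz).2
    simp only [Finset.sum_add_distrib, ← Finset.sum_mul, ← Finset.mul_sum, hrow] at hle
    simpa [matInner] using hle
  rw [eq_sub_iff_add_eq] at hgap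
  have e := congrArg (fun y => w * y) hgap
  linarith

/-- Optimistic FTRL with the adaptive entropic regularizer on the multi-simplex:
regret bound `∑ ⟨c_t, x − x_t⟩ ≤ (4√2·I/η + η·I·log J)·√(∑ ‖c_t − c̃_t‖_∞²)`.
The sup norm `‖·‖` on `Fin I → Fin J → ℝ` is the `ℓ∞` norm `max_{i,j} |c_{ij}|`.
Indices are 0-based: slots are `0, …, T−1`. -/
theorem oftrl_entropic_regret
    (I J T : ℕ) (hI : 1 ≤ I) (hJ : 2 ≤ J) (hT : 1 ≤ T)
    (c cpred : ℕ → Fin I → Fin J → ℝ)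
    (xs : ℕ → Fin I → Fin J → ℝ)
    (η : ℝ) (hη : η = min (1 / 2) (Real.sqrt (2 * Real.sqrt 2 / Real.log J)))
    (η1 : ℕ → ℝ)
    (hη1 : ∀ t, η1 t = η * Real.sqrt (∑ τ ∈ Finset.range t, ‖c τ - cpred τ‖ ^ 2))
    (r : ℝ → (Fin I → Fin J → ℝ) → ℝ)
    (hr : ∀ w x, r w x = w / 2 * (I * Real.log J + ∑ i, ∑ j, x i j * Real.log (x i j)))
    (hinit : xs 0 ∈ multiSimplex I J ∧ ∀ x ∈ multiSimplex I J,
      -(matInner (xs 0) (cpred 0)) ≤ -(matInner x (cpred 0)))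
    (hupdate : ∀ t, 1 ≤ t → t ≤ T - 1 →
      xs t ∈ multiSimplex I J ∧ ∀ x ∈ multiSimplex I J,
        r (η1 t) (xs t) - matInner (xs t) ((∑ τ ∈ Finset.range t, c τ) + cpred t) ≤
        r (η1 t) x - matInner x ((∑ τ ∈ Finset.range t, c τ) + cpred t)) :
    ∀ x ∈ multiSimplex I J,
      ∑ t ∈ Finset.range T, matInner (c t) (x - xs t) ≤
        (4 * Real.sqrt 2 * I / η + η * I * Real.log J) *
          Real.sqrt (∑ t ∈ Finset.range T, ‖c t - cpred t‖ ^ 2) := by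
  have hlogJ : 0 < Real.log J := Real.log_pos (by exact_mod_cast hJ)
  have hηpos : 0 < η := by
    rw [hη]
    exact lt_min (by norm_num) (Real.sqrt_pos.2 (by positivity))
  have hη2 : η ≤ 1 / 2 := hη ▸ min_le_left _ _
  let S : ℕ → ℝ := fun t => Real.sqrt (∑ τ ∈ Finset.range t, ‖c τ - cpred τ‖ ^ 2)
  have hS0 : ∀ t, 0 ≤ S t := fun t => Real.sqrt_nonneg _
  have hSsq : ∀ t, S (t + 1) ^ 2 = S t ^ 2 + ‖c t - cpred t‖ ^ 2 := by
    intro t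
    simp only [S]
    rw [Real.sq_sqrt (by positivity), Real.sq_sqrt (by positivity), Finset.sum_range_succ]
  have hSmono : ∀ t, S t ≤ S (t + 1) := fun t => by
    nlinarith [hS0 t, hS0 (t + 1), hSsq t, sq_nonneg ‖c t - cpred t‖]
  have hη1S : ∀ t, η1 t = η * S t := hη1
  have hopt : ∀ t < T, xs t ∈ multiSimplex I J ∧ ∀ x ∈ multiSimplex I J,
      r (η1 t) (xs t) - matInner (xs t) ((∑ τ ∈ Finset.range t, c τ) + cpred t) ≤
      r (η1 t) x - matInner x ((∑ τ ∈ Finset.range t, c τ) + cpred t) := by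
    intro t ht
    rcases Nat.eq_zero_or_pos t with rfl | hpos
    · simpa [hη1, hr] using hinit
    · exact hupdate t hpos (by omega)
  have hlower : ∀ t ≤ T, ∀ z ∈ multiSimplex I J,
      -(∑ τ ∈ Finset.range t, matInner (c τ) (xs τ)) - I * (4 * Real.sqrt 2 / η * S t) ≤
        r (η1 t) z - matInner z (∑ τ ∈ Finset.range t, c τ) := by
    intro t
    induction t with
    | zero =>
      intro _ z _
      simp [hη1, hr, S, matInner]
    | succ t ih =>
      intro ht z hz
      obtain ⟨hxt, hmin⟩ := hopt t (by omega)
      have hprev := ih (by omega) (xs t) hxt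
      have hstab := entropic_minimizer_stability (w := η1 t) (K := I * Real.log J)
        (g := c t - cpred t)
        (by rw [hη1S]; exact mul_nonneg hηpos.le (hS0 t)) hxt hz
        (by simpa only [hr] using hmin)
        (fun i j => (norm_le_pi_norm ((c t - cpred t) i) j).trans
          (norm_le_pi_norm (c t - cpred t) i))
        (by
          rw [hη1S]
          exact stability_increment (norm_nonneg _) (hS0 t) (hS0 (t + 1)) (hSsq t) hηpos hη2)
      rw [← hr, ← hr, matInner_sub_right, matInner_comm _ z, matInner_comm _ (xs t),
        matInner_sub_right, matInner_sub_right, matInner_add_right, matInner_add_right] at hstab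
      have hreg : r (η1 t) z ≤ r (η1 (t + 1)) z := by
        rw [hr, hr]
        refine mul_le_mul_of_nonneg_right ?_ (entropy_nonneg (by omega) hz)
        rw [hη1S, hη1S]
        linarith [mul_le_mul_of_nonneg_left (hSmono t) hηpos.le]
      rw [Finset.sum_range_succ, Finset.sum_range_succ, matInner_add_right,
        matInner_comm (c t) (xs t)]
      linarith
  intro x hx
  have hfin := hlower T le_rfl x hx
  have hinner : ∀ t, matInner x (∑ τ ∈ Finset.range t, c τ) =
      ∑ τ ∈ Finset.range t, matInner (c τ) x := by
    intro t
    induction t with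
    | zero => simp [matInner]
    | succ t ih =>
      rw [Finset.sum_range_succ, Finset.sum_range_succ, matInner_add_right, ih,
        matInner_comm (c t)]
  have hrT : r (η1 T) x ≤ η * I * Real.log J * S T := by
    rw [hr, hη1S]
    have hηS : 0 ≤ η * S T := mul_nonneg hηpos.le (hS0 T)
    have hent := sum_mul_log_nonpos hx
    have hIJ : 0 ≤ η * S T * (I * Real.log J) := by positivity
    nlinarith [mul_nonneg hηS (neg_nonneg.2 hent)]
  rw [hinner] at hfin
  simp only [matInner_sub_right, Finset.sum_sub_distrib]
  change _ ≤ _ * S T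
  have e : (4 * Real.sqrt 2 * I / η + η * I * Real.log J) * S T =
      I * (4 * Real.sqrt 2 / η * S T) + η * I * Real.log J * S T := by ring
  rw [e]
  linarith
end

section
/- Let I, J ≥ 1 and η ≥ 0, and define r(x) = (η/2)·( I·log J + Σ_{i,j} x_{ij}·log x_{ij} ) on the multi-simplex 𝒳 ⊆ ℝ^{I×J}. Then for all x, y ∈ 𝒳 such that x_{ij} > 0 for every i, j, one has r(y) ≥ r(x) + (η/2)·Σ_{i,j} (log x_{ij} + 1)·(y_{ij} − x_{ij}) + (η/(4I))·( Σ_{i,j} |y_{ij} − x_{ij}| )². That is, r is strongly convex on the multi-simplex with respect to the ℓ¹ norm with modulus η/(2I). -/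
/-- A Padé-type lower bound for the logarithm, touching to third order at `1`. -/
lemma pade_le_log {t : ℝ} (ht : 0 < t) :
    (t - 1) * (5 * t + 1) / (2 * t * (t + 2)) ≤ Real.log t := by
  set g : ℝ → ℝ := fun s => Real.log s - (s - 1) * (5 * s + 1) / (2 * s * (s + 2)) with hg
  have hderiv : ∀ s : ℝ, 0 < s → HasDerivAt g ((s - 1) ^ 3 / (s ^ 2 * (s + 2) ^ 2)) s := by
    intro s hs
    have hnum : HasDerivAt (fun s : ℝ => (s - 1) * (5 * s + 1))
        (1 * (5 * s + 1) + (s - 1) * (5 * 1)) s :=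
      ((hasDerivAt_id' s).sub_const 1).mul (((hasDerivAt_id' s).const_mul 5).add_const 1)
    have hden : HasDerivAt (fun s : ℝ => 2 * s * (s + 2))
        (2 * 1 * (s + 2) + 2 * s * 1) s :=
      ((hasDerivAt_id' s).const_mul 2).mul ((hasDerivAt_id' s).add_const 2)
    have hden0 : 2 * s * (s + 2) ≠ 0 := by positivity
    have : s + 2 ≠ 0 := by positivity
    refine ((Real.hasDerivAt_log hs.ne').sub (hnum.div hden hden0)).congr_deriv ?_
    field_simp
    ring
  have hg1 : g 1 = 0 := by simp [hg]
  suffices 0 ≤ g t by simpa [hg] using this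
  rw [← hg1]
  rcases le_total t 1 with h | h
  · have hanti : AntitoneOn g (Set.Icc t 1) := by
      refine antitoneOn_of_hasDerivWithinAt_nonpos (convex_Icc t 1)
        (f' := fun s => (s - 1) ^ 3 / (s ^ 2 * (s + 2) ^ 2))
        (fun s hs => (hderiv s (ht.trans_le hs.1)).continuousAt.continuousWithinAt)
        (fun s hs => (hderiv s (ht.trans_le (interior_subset hs).1)).hasDerivWithinAt) ?_
      intro s hs
      have hs1 : s - 1 ≤ 0 := sub_nonpos.2 (interior_subset hs).2
      exact div_nonpos_of_nonpos_of_nonneg (Odd.pow_nonpos (by decide) hs1) (by positivity)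
    exact hanti (Set.left_mem_Icc.2 h) (Set.right_mem_Icc.2 h) h
  · have hmono : MonotoneOn g (Set.Icc 1 t) := by
      refine monotoneOn_of_hasDerivWithinAt_nonneg (convex_Icc 1 t)
        (f' := fun s => (s - 1) ^ 3 / (s ^ 2 * (s + 2) ^ 2))
        (fun s hs => (hderiv s (one_pos.trans_le hs.1)).continuousAt.continuousWithinAt)
        (fun s hs =>
          (hderiv s (one_pos.trans_le (interior_subset hs).1)).hasDerivWithinAt) ?_
      intro s hs
      have hs1 : 0 ≤ s - 1 := sub_nonneg.2 (interior_subset hs).1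
      positivity
    exact hmono (Set.left_mem_Icc.2 h) (Set.right_mem_Icc.2 h) h

/-- The Bregman divergence of `u ↦ u * log u` dominates a weighted square. -/
lemma sq_div_le_bregman_mul_log {a b : ℝ} (ha : 0 < a) (hb : 0 ≤ b) :
    3 / 2 * ((b - a) ^ 2 / (b + 2 * a)) ≤
      b * Real.log b - a * Real.log a - (Real.log a + 1) * (b - a) := by
  rcases hb.eq_or_lt with rfl | hb
  · have : 3 / 2 * ((0 - a) ^ 2 / (0 + 2 * a)) = 3 / 4 * a := by
      field_simp
      ring
    rw [this]
    simp only [zero_mul]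
    linarith
  · have h := mul_le_mul_of_nonneg_left (pade_le_log (div_pos hb ha)) hb.le
    rw [Real.log_div hb.ne' ha.ne'] at h
    have h_eq : b * ((b / a - 1) * (5 * (b / a) + 1) / (2 * (b / a) * (b / a + 2))) =
        3 / 2 * ((b - a) ^ 2 / (b + 2 * a)) + (b - a) := by
      have : b + 2 * a ≠ 0 := by positivity
      have : b / a + 2 ≠ 0 := by positivity
      field_simp
      ring
    rw [h_eq] at h
    linarith

/-- Pinsker's inequality on a finite type, in Bregman form. -/
lemma half_sq_sum_abs_le_sum_bregman_mul_log {ι : Type*} [Fintype ι] {p q : ι → ℝ}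
    (hp : ∀ j, 0 < p j) (hq : ∀ j, 0 ≤ q j) (hp1 : ∑ j, p j = 1) (hq1 : ∑ j, q j = 1) :
    1 / 2 * (∑ j, |q j - p j|) ^ 2 ≤
      ∑ j, (q j * Real.log (q j) - p j * Real.log (p j) -
        (Real.log (p j) + 1) * (q j - p j)) := by
  have hpos : ∀ j, 0 < q j + 2 * p j := fun j => by linarith [hp j, hq j]
  have hcs := Finset.sq_sum_div_le_sum_sq_div Finset.univ (fun j => |q j - p j|)
    (g := fun j => q j + 2 * p j) (fun j _ => hpos j)
  have hsum : ∑ j, (q j + 2 * p j) = 3 := by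
    rw [Finset.sum_add_distrib, ← Finset.mul_sum, hp1, hq1]
    norm_num
  simp only [hsum, sq_abs] at hcs
  calc 1 / 2 * (∑ j, |q j - p j|) ^ 2
      ≤ 3 / 2 * ∑ j, (q j - p j) ^ 2 / (q j + 2 * p j) := by linarith
    _ = ∑ j, 3 / 2 * ((q j - p j) ^ 2 / (q j + 2 * p j)) := Finset.mul_sum ..
    _ ≤ _ := Finset.sum_le_sum fun j _ => sq_div_le_bregman_mul_log (hp j) (hq j)

/-- The entropic regularizer `r(x) = (η/2)(I log J + ∑_{ij} x_{ij} log x_{ij})` is strongly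
convex on the multi-simplex w.r.t. the `ℓ¹` norm with modulus `η/(2I)`:
its value at `y` dominates the first-order expansion around an interior point `x`
plus `(η/(4I))·‖y − x‖₁²`. -/
theorem entropic_regularizer_strongly_convex
    (I J : ℕ) (hI : 1 ≤ I) (hJ : 1 ≤ J) (η : ℝ) (hη : 0 ≤ η)
    (x y : Fin I → Fin J → ℝ)
    (hx : x ∈ multiSimplex I J) (hy : y ∈ multiSimplex I J)
    (hxpos : ∀ i j, 0 < x i j) :
    η / 2 * (I * Real.log J + ∑ i, ∑ j, y i j * Real.log (y i j)) ≥
      η / 2 * (I * Real.log J + ∑ i, ∑ j, x i j * Real.log (x i j)) +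
        η / 2 * ∑ i, ∑ j, (Real.log (x i j) + 1) * (y i j - x i j) +
        η / (4 * I) * (∑ i, ∑ j, |y i j - x i j|) ^ 2 := by
  have hrow : ∑ i, 1 / 2 * (∑ j, |y i j - x i j|) ^ 2 ≤
      ∑ i, ∑ j, (y i j * Real.log (y i j) - x i j * Real.log (x i j) -
        (Real.log (x i j) + 1) * (y i j - x i j)) :=
    Finset.sum_le_sum fun i _ => half_sq_sum_abs_le_sum_bregman_mul_log
      (hxpos i) (hy.1 i) (hx.2 i) (hy.2 i)
  simp only [Finset.sum_sub_distrib] at hrow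
  rw [← Finset.mul_sum] at hrow
  have hI0 : (0 : ℝ) < I := by exact_mod_cast hI
  have hcs : (∑ i, ∑ j, |y i j - x i j|) ^ 2 / I ≤ ∑ i, (∑ j, |y i j - x i j|) ^ 2 := by
    rw [div_le_iff₀' hI0]
    simpa using sq_sum_le_card_mul_sum_sq (s := Finset.univ)
      (f := fun i => ∑ j, |y i j - x i j|)
  have h_coeff : η / (4 * I) * (∑ i, ∑ j, |y i j - x i j|) ^ 2 =
      η / 2 * (1 / 2 * ((∑ i, ∑ j, |y i j - x i j|) ^ 2 / I)) := by
    field_simp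
    ring
  rw [h_coeff, ge_iff_le, ← mul_add, ← mul_add]
  refine mul_le_mul_of_nonneg_left ?_ (by positivity)
  linarith
end

section
/- Let α, β > 0 with α ≠ 1 and β ≠ 1, let 0 < u_min ≤ u_max and 0 < h_min ≤ h_max, and set Θ = [−u_min^{−α}, −u_max^{−α}]^I ⊆ ℝ^I and Φ = [−h_min^{−β}, −h_max^{−β}]^J ⊆ ℝ^J. Let 𝒳 be any nonempty set, T ≥ 1, and for each t = 1,…,T let u_t : 𝒳 → [u_min, u_max]^I and h_t : 𝒳 → [h_min, h_max]^J. Define the proxy functions Ψ_t^α(θ, x) = Σ_{i=1}^I g_α(θ_i) − ⟨θ, u_t(x)⟩ and Ψ_t^β(φ, x) = Σ_{j=1}^J g_β(φ_j) − ⟨φ, h_t(x)⟩. Let x₁,…,x_T ∈ 𝒳, θ₁,…,θ_T ∈ Θ, φ₁,…,φ_T ∈ Φ, x* ∈ 𝒳, and set θ̄ = (1/T)Σ_{t=1}^T θ_t, φ̄ = (1/T)Σ_{t=1}^T φ_t. Assume the real numbers B_x, B_θ, B_φ satisfy: (i) Σ_{t=1}^T [ Ψ_t^α(θ_t, x*)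 + Ψ_t^β(φ_t, x*) − Ψ_t^α(θ_t, x_t) − Ψ_t^β(φ_t, x_t) ] ≤ B_x; (ii) Σ_{t=1}^T [ Ψ_t^α(θ_t, x_t) − Ψ_t^α(θ, x_t) ] ≤ B_θ for every θ ∈ Θ; (iii) Σ_{t=1}^T [ Ψ_t^β(φ_t, x_t) − Ψ_t^β(φ, x_t) ] ≤ B_φ for every φ ∈ Φ. Then F_α( (1/T)Σ_{t=1}^T u_t(x*) ) + F_β( (1/T)Σ_{t=1}^T h_t(x*) ) − F_α( (1/T)Σ_{t=1}^T u_t(x_t) ) − F_β( (1/T)Σ_{t=1}^T h_t(x_t) ) ≤ (B_x + B_θ + B_φ)/T + (1/T)Σ_{t=1}^T ⟨θ_t − θ̄, u_t(x*)⟩ + (1/T)Σ_{t=1}^T ⟨φ_t − φ̄, h_t(x*)⟩. -/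
/-- The α-fairness function `f_α(u) = (u^{1−α} − 1)/(1−α)` (for `α ≠ 1`). -/
noncomputable def fAlpha (α u : ℝ) : ℝ := (u ^ (1 - α) - 1) / (1 - α)

/-- The vector α-fairness function `F_α(v) = ∑_k f_α(v_k)`. -/
noncomputable def FAlpha (α : ℝ) {K : ℕ} (v : Fin K → ℝ) : ℝ := ∑ k, fAlpha α (v k)

/-- The conjugate expression `g_α(θ) = (α·(−θ)^{1−1/α} − 1)/(1−α)` (for `α ≠ 1`, `θ < 0`). -/
noncomputable def gAlpha (α θ : ℝ) : ℝ := (α * (-θ) ^ (1 - 1 / α) - 1) / (1 - α)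

/-- Bernoulli's inequality for exponents `1 - α < 1`, divided by `1 - α`. -/
lemma rpow_one_sub_sub_div_le {α r : ℝ} (hα : 0 < α) (hα1 : α ≠ 1) (hr : 0 < r) :
    (r ^ (1 - α) - α) / (1 - α) ≤ r := by
  rcases lt_or_gt_of_ne hα1 with h | h
  · have hb := rpow_one_add_le_one_add_mul_self (s := r - 1) (by linarith)
      (p := 1 - α) (by linarith) (by linarith)
    rw [add_sub_cancel] at hb
    rw [div_le_iff₀ (by linarith)]
    linarith
  · have he := Real.add_one_le_exp (Real.log r * (1 - α))
    rw [← Real.rpow_def_of_pos hr] at he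
    have hl := mul_le_mul_of_nonpos_right (Real.log_le_sub_one_of_pos hr)
      (by linarith : 1 - α ≤ 0)
    rw [div_le_iff_of_neg (by linarith)]
    linarith

/-- The value of `gAlpha` at the dual point `-w ^ (-α)`. -/
lemma gAlpha_neg_rpow {α w : ℝ} (hα : 0 < α) (hw : 0 < w) :
    gAlpha α (-w ^ (-α)) = (α * w ^ (1 - α) - 1) / (1 - α) := by
  have he : -α * (1 - 1 / α) = 1 - α := by field_simp; ring
  rw [gAlpha, neg_neg, ← Real.rpow_mul hw.le, he]

/-- Equality case of the Fenchel–Young inequality. -/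
lemma gAlpha_sub_mul_eq_fAlpha {α w : ℝ} (hα : 0 < α) (hα1 : α ≠ 1) (hw : 0 < w) :
    gAlpha α (-w ^ (-α)) - -w ^ (-α) * w = fAlpha α w := by
  have hne : 1 - α ≠ 0 := sub_ne_zero.2 hα1.symm
  have hmul : w ^ (-α) * w = w ^ (1 - α) := by
    rw [← Real.rpow_add_one hw.ne']; congr 1; ring
  rw [gAlpha_neg_rpow hα hw, neg_mul, hmul, fAlpha]
  field_simp
  ring

/-- The Fenchel–Young inequality for the α-fairness function. -/
lemma fAlpha_le_gAlpha_sub_mul {α v θ : ℝ} (hα : 0 < α) (hα1 : α ≠ 1) (hv : 0 < v)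
    (hθ : θ < 0) : fAlpha α v ≤ gAlpha α θ - θ * v := by
  have hne : 1 - α ≠ 0 := sub_ne_zero.2 hα1.symm
  obtain ⟨w, hw, rfl⟩ : ∃ w : ℝ, 0 < w ∧ θ = -w ^ (-α) := by
    have hs : 0 < -θ := neg_pos.2 hθ
    refine ⟨(-θ) ^ (-α)⁻¹, Real.rpow_pos_of_pos hs _, ?_⟩
    rw [Real.rpow_inv_rpow hs.le (neg_ne_zero.2 hα.ne'), neg_neg]
  have hb := mul_le_mul_of_nonneg_left (rpow_one_sub_sub_div_le hα hα1 (div_pos hv hw))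
    (Real.rpow_pos_of_pos hw (1 - α)).le
  have hpos := Real.rpow_pos_of_pos hw (1 - α)
  have hmul : w ^ (1 - α) * (v / w) = w ^ (-α) * v := by
    have : w ^ (1 - α) = w ^ (-α) * w := by
      rw [← Real.rpow_add_one hw.ne']; congr 1; ring
    rw [this]; field_simp
  have hdiv : w ^ (1 - α) * (((v / w) ^ (1 - α) - α) / (1 - α)) =
      fAlpha α v - (α * w ^ (1 - α) - 1) / (1 - α) := by
    rw [Real.div_rpow hv.le hw.le, fAlpha]
    field_simp
    ring
  rw [gAlpha_neg_rpow hα hw]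
  linarith

lemma average_mem_Icc {T : ℕ} (hT : 1 ≤ T) {a b : ℝ} {c : ℕ → ℝ}
    (hc : ∀ t < T, c t ∈ Set.Icc a b) :
    (1 / T : ℝ) * ∑ t ∈ Finset.range T, c t ∈ Set.Icc a b := by
  have hT0 : (0 : ℝ) < T := by exact_mod_cast hT
  have hlo := Finset.card_nsmul_le_sum (Finset.range T) c a
    fun t ht => (hc t (Finset.mem_range.1 ht)).1
  have hhi := Finset.sum_le_card_nsmul (Finset.range T) c b
    fun t ht => (hc t (Finset.mem_range.1 ht)).2
  rw [Finset.card_range, nsmul_eq_mul] at hlo hhi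
  rw [one_div_mul_eq_div]
  exact ⟨(le_div_iff₀ hT0).2 (by linarith), (div_le_iff₀ hT0).2 (by linarith)⟩

/-- The fairness of an average is bounded by the averaged proxy values plus the deviations of
the dual iterates from their mean. -/
lemma mul_FAlpha_average_le {K T : ℕ} {α : ℝ} (hα : 0 < α) (hα1 : α ≠ 1)
    {θs a : ℕ → Fin K → ℝ} (hθs : ∀ t < T, ∀ k, θs t k < 0)
    (ha : ∀ k, 0 < (1 / T : ℝ) * ∑ t ∈ Finset.range T, a t k)
    {θbar : Fin K → ℝ} (hθbar : ∀ k, θbar k = (1 / T : ℝ) * ∑ t ∈ Finset.range T, θs t k) :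
    T * FAlpha α (fun k => (1 / T : ℝ) * ∑ t ∈ Finset.range T, a t k) ≤
      ∑ t ∈ Finset.range T, ((∑ k, gAlpha α (θs t k)) - ∑ k, θs t k * a t k) +
        ∑ t ∈ Finset.range T, ∑ k, (θs t k - θbar k) * a t k := by
  have hcoord : ∀ k, T * fAlpha α ((1 / T : ℝ) * ∑ t ∈ Finset.range T, a t k) ≤
      ∑ t ∈ Finset.range T, (gAlpha α (θs t k) - θbar k * a t k) := by
    intro k
    have hsum := Finset.card_nsmul_le_sum (Finset.range T) _ _ fun t ht =>
      fAlpha_le_gAlpha_sub_mul hα hα1 (ha k) (hθs t (Finset.mem_range.1 ht) k)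
    rw [Finset.card_range, nsmul_eq_mul] at hsum
    refine hsum.trans_eq ?_
    rw [Finset.sum_sub_distrib, Finset.sum_sub_distrib, ← Finset.sum_mul, ← Finset.mul_sum,
      hθbar k]
    ring
  rw [FAlpha, Finset.mul_sum]
  refine (Finset.sum_le_sum fun k _ => hcoord k).trans_eq ?_
  rw [Finset.sum_comm, ← Finset.sum_add_distrib]
  refine Finset.sum_congr rfl fun t _ => ?_
  rw [← Finset.sum_sub_distrib, ← Finset.sum_add_distrib]
  exact Finset.sum_congr rfl fun k _ => by ring

/-- The proxy functions at the dual point optimal for the average add up to the fairness of the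
average. -/
lemma sum_proxy_eq_mul_FAlpha_average {K T : ℕ} (hT : 1 ≤ T) {α : ℝ} (hα : 0 < α)
    (hα1 : α ≠ 1) {b : ℕ → Fin K → ℝ} {m : Fin K → ℝ}
    (hm : ∀ k, m k = (1 / T : ℝ) * ∑ t ∈ Finset.range T, b t k) (hpos : ∀ k, 0 < m k) :
    ∑ t ∈ Finset.range T,
      ((∑ k, gAlpha α (-m k ^ (-α))) - ∑ k, -m k ^ (-α) * b t k) = T * FAlpha α m := by
  have hT0 : (T : ℝ) ≠ 0 := by exact_mod_cast (by omega : T ≠ 0)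
  simp_rw [← Finset.sum_sub_distrib]
  rw [Finset.sum_comm, FAlpha, Finset.mul_sum]
  refine Finset.sum_congr rfl fun k _ => ?_
  have hsum : ∑ t ∈ Finset.range T, b t k = T * m k := by rw [hm k]; field_simp
  rw [Finset.sum_sub_distrib, ← Finset.mul_sum, hsum, Finset.sum_const, Finset.card_range,
    nsmul_eq_mul, ← gAlpha_sub_mul_eq_fAlpha hα hα1 (hpos k)]
  ring

/-- One-sided form of the saddle-point decomposition, multiplied by the horizon. -/
lemma mul_fairness_regret_le {K T : ℕ} (hT : 1 ≤ T) {α lo hi : ℝ} (hα : 0 < α) (hα1 : α ≠ 1)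
    (hlo : 0 < lo) {a b θs : ℕ → Fin K → ℝ}
    (ha : ∀ t < T, ∀ k, a t k ∈ Set.Icc lo hi) (hb : ∀ t < T, ∀ k, b t k ∈ Set.Icc lo hi)
    (hlohi : lo ≤ hi)
    (hθs : ∀ t < T, ∀ k, θs t k ∈ Set.Icc (-lo ^ (-α)) (-hi ^ (-α)))
    {θbar : Fin K → ℝ} (hθbar : ∀ k, θbar k = (1 / T : ℝ) * ∑ t ∈ Finset.range T, θs t k)
    {B : ℝ}
    (hB : ∀ θ : Fin K → ℝ, (∀ k, θ k ∈ Set.Icc (-lo ^ (-α)) (-hi ^ (-α))) →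
      ∑ t ∈ Finset.range T, (((∑ k, gAlpha α (θs t k)) - ∑ k, θs t k * b t k) -
        ((∑ k, gAlpha α (θ k)) - ∑ k, θ k * b t k)) ≤ B) :
    T * FAlpha α (fun k => (1 / T : ℝ) * ∑ t ∈ Finset.range T, a t k) -
        T * FAlpha α (fun k => (1 / T : ℝ) * ∑ t ∈ Finset.range T, b t k) ≤
      ∑ t ∈ Finset.range T, (((∑ k, gAlpha α (θs t k)) - ∑ k, θs t k * a t k) -
        ((∑ k, gAlpha α (θs t k)) - ∑ k, θs t k * b t k)) + B +
        ∑ t ∈ Finset.range T, ∑ k, (θs t k - θbar k) * a t k := by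
  have hpos : ∀ t < T, ∀ k, θs t k < 0 := fun t ht k =>
    (hθs t ht k).2.trans_lt (neg_neg_of_pos (Real.rpow_pos_of_pos (hlo.trans_le hlohi) _))
  have hmem : ∀ k, (1 / T : ℝ) * ∑ t ∈ Finset.range T, b t k ∈ Set.Icc lo hi := fun k =>
    average_mem_Icc hT fun t ht => hb t ht k
  have hprimal := mul_FAlpha_average_le hα hα1 hpos
    (fun k => hlo.trans_le (average_mem_Icc hT fun t ht => ha t ht k).1) hθbar
  have hval := sum_proxy_eq_mul_FAlpha_average hT hα hα1 (b := b) (fun _ => rfl)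
    fun k => hlo.trans_le (hmem k).1
  have hdual := hB (fun k => -((1 / T : ℝ) * ∑ t ∈ Finset.range T, b t k) ^ (-α)) fun k =>
    ⟨neg_le_neg (Real.rpow_le_rpow_of_nonpos hlo (hmem k).1 (by linarith)),
      neg_le_neg (Real.rpow_le_rpow_of_nonpos (hlo.trans_le (hmem k).1) (hmem k).2
        (by linarith))⟩
  rw [Finset.sum_sub_distrib] at hdual ⊢
  linarith

/-- Saddle-point decomposition for the two-sided horizon-fairness regret: the fairness
regret at a comparator `x*` is bounded by the primal proxy regret, the two dual proxy
regrets, and the deviations of the dual iterates from their time averages.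
`Ψ_t^α(θ, x) = ∑_i g_α(θ_i) − ⟨θ, u_t(x)⟩`, `Ψ_t^β(φ, x) = ∑_j g_β(φ_j) − ⟨φ, h_t(x)⟩`.
Slots are indexed `0, …, T−1`. -/
theorem two_sided_fairness_regret_decomposition
    {𝒳 : Type*} [Nonempty 𝒳] (I J T : ℕ) (hT : 1 ≤ T)
    (α β : ℝ) (hα : 0 < α) (hα1 : α ≠ 1) (hβ : 0 < β) (hβ1 : β ≠ 1)
    (umin umax hmin hmax : ℝ)
    (humin : 0 < umin) (huminmax : umin ≤ umax)
    (hhmin : 0 < hmin) (hhminmax : hmin ≤ hmax)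
    (u : ℕ → 𝒳 → Fin I → ℝ) (h : ℕ → 𝒳 → Fin J → ℝ)
    (hu : ∀ t < T, ∀ x i, u t x i ∈ Set.Icc umin umax)
    (hh : ∀ t < T, ∀ x j, h t x j ∈ Set.Icc hmin hmax)
    (Ψα : ℕ → (Fin I → ℝ) → 𝒳 → ℝ) (Ψβ : ℕ → (Fin J → ℝ) → 𝒳 → ℝ)
    (hΨα : ∀ t θ x, Ψα t θ x = (∑ i, gAlpha α (θ i)) - ∑ i, θ i * u t x i)
    (hΨβ : ∀ t φ x, Ψβ t φ x = (∑ j, gAlpha β (φ j)) - ∑ j, φ j * h t x j)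
    (xs : ℕ → 𝒳) (θs : ℕ → Fin I → ℝ) (φs : ℕ → Fin J → ℝ) (xstar : 𝒳)
    (hθs : ∀ t < T, ∀ i, θs t i ∈ Set.Icc (-umin ^ (-α)) (-umax ^ (-α)))
    (hφs : ∀ t < T, ∀ j, φs t j ∈ Set.Icc (-hmin ^ (-β)) (-hmax ^ (-β)))
    (θbar : Fin I → ℝ) (hθbar : ∀ i, θbar i = (1 / T : ℝ) * ∑ t ∈ Finset.range T, θs t i)
    (φbar : Fin J → ℝ) (hφbar : ∀ j, φbar j = (1 / T : ℝ) * ∑ t ∈ Finset.range T, φs t j)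
    (Bx Bθ Bφ : ℝ)
    (hBx : ∑ t ∈ Finset.range T,
        (Ψα t (θs t) xstar + Ψβ t (φs t) xstar - Ψα t (θs t) (xs t) - Ψβ t (φs t) (xs t))
      ≤ Bx)
    (hBθ : ∀ θ : Fin I → ℝ, (∀ i, θ i ∈ Set.Icc (-umin ^ (-α)) (-umax ^ (-α))) →
      ∑ t ∈ Finset.range T, (Ψα t (θs t) (xs t) - Ψα t θ (xs t)) ≤ Bθ)
    (hBφ : ∀ φ : Fin J → ℝ, (∀ j, φ j ∈ Set.Icc (-hmin ^ (-β)) (-hmax ^ (-β))) →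
      ∑ t ∈ Finset.range T, (Ψβ t (φs t) (xs t) - Ψβ t φ (xs t)) ≤ Bφ) :
    FAlpha α (fun i => (1 / T : ℝ) * ∑ t ∈ Finset.range T, u t xstar i) +
      FAlpha β (fun j => (1 / T : ℝ) * ∑ t ∈ Finset.range T, h t xstar j) -
      FAlpha α (fun i => (1 / T : ℝ) * ∑ t ∈ Finset.range T, u t (xs t) i) -
      FAlpha β (fun j => (1 / T : ℝ) * ∑ t ∈ Finset.range T, h t (xs t) j) ≤
    (Bx + Bθ + Bφ) / T +
      (1 / T : ℝ) * ∑ t ∈ Finset.range T, ∑ i, (θs t i - θbar i) * u t xstar i +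
      (1 / T : ℝ) * ∑ t ∈ Finset.range T, ∑ j, (φs t j - φbar j) * h t xstar j := by
  have hT0 : (0 : ℝ) < T := by exact_mod_cast hT
  simp only [hΨα, hΨβ] at hBx hBθ hBφ
  have hu' := mul_fairness_regret_le hT hα hα1 humin (fun t ht => hu t ht xstar)
    (fun t ht => hu t ht (xs t)) huminmax hθs hθbar hBθ
  have hh' := mul_fairness_regret_le hT hβ hβ1 hhmin (fun t ht => hh t ht xstar)
    (fun t ht => hh t ht (xs t)) hhminmax hφs hφbar hBφ
  simp only [Finset.sum_add_distrib, Finset.sum_sub_distrib] at hBx hu' hh' ⊢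
  rw [one_div_mul_eq_div, one_div_mul_eq_div, ← add_div, ← add_div, le_div_iff₀ hT0]
  linarith
end

section
/- Let α > 0 with α ≠ 1, and let reals a, b, u satisfy 0 < a ≤ u ≤ b. Then the function θ ↦ g_α(θ) − θ·u on the interval [−a^{−α}, −b^{−α}] attains its minimum at θ = −u^{−α}, and the minimum value equals f_α(u) = (u^{1−α} − 1)/(1−α). That is, min_{θ ∈ [−a^{−α}, −b^{−α}]} { ( α·(−θ)^{1−1/α} − 1 )/(1−α) − θ·u } = (u^{1−α} − 1)/(1−α). -/
/-- Bernoulli's inequality for both ranges of the exponent, divided by `1 - α`. -/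
theorem rpow_div_one_sub_le {α t : ℝ} (hα : 0 < α) (hα1 : α ≠ 1) (ht : 0 ≤ t) :
    t ^ α / (1 - α) ≤ α * t / (1 - α) + 1 := by
  have hne : 1 - α ≠ 0 := sub_ne_zero.mpr hα1.symm
  have hs : α * t / (1 - α) + 1 = (1 + α * (t - 1)) / (1 - α) := by
    field_simp
    ring
  rw [hs]
  rcases lt_or_gt_of_ne hα1 with h | h
  · have hb := rpow_one_add_le_one_add_mul_self (s := t - 1) (by linarith) hα.le h.le
    rw [add_sub_cancel] at hb
    exact div_le_div_of_nonneg_right hb (by linarith)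
  · have hb := one_add_mul_self_le_rpow_one_add (s := t - 1) (by linarith) h.le
    rw [add_sub_cancel] at hb
    exact div_le_div_of_nonpos_of_le (by linarith) hb

/-- The weak duality inequality `f_α(u) ≤ g_α(θ) - θ u` on the whole half-line `θ < 0`. -/
theorem fAlpha_le_gAlpha_sub {α u θ : ℝ} (hα : 0 < α) (hα1 : α ≠ 1) (hu : 0 < u) (hθ : θ < 0) :
    fAlpha α u ≤ gAlpha α θ - θ * u := by
  obtain ⟨w, rfl⟩ : ∃ w, θ = -w := ⟨-θ, by ring⟩
  have hw : 0 < w := by linarith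
  set t := w ^ (-(1 / α)) / u with ht
  have htpos : 0 < t := by positivity
  have hy : w * t ^ α = u ^ (-α) := by
    rw [ht, Real.div_rpow (by positivity) hu.le, ← Real.rpow_mul hw.le,
      show -(1 / α) * α = -1 by field_simp, Real.rpow_neg_one, Real.rpow_neg hu.le]
    field_simp
  have hg : w ^ (1 - 1 / α) = w * t * u := by
    rw [sub_eq_add_neg, Real.rpow_add hw, Real.rpow_one, ht]
    field_simp
  have hf : u ^ (1 - α) = u * (w * t ^ α) := by
    rw [hy, sub_eq_add_neg, Real.rpow_add hu, Real.rpow_one]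
  unfold fAlpha gAlpha
  rw [neg_neg, hg, hf]
  have hb := mul_le_mul_of_nonneg_left (rpow_div_one_sub_le hα hα1 htpos.le) (mul_pos hu hw).le
  calc (u * (w * t ^ α) - 1) / (1 - α) = u * w * (t ^ α / (1 - α)) - 1 / (1 - α) := by ring
    _ ≤ u * w * (α * t / (1 - α) + 1) - 1 / (1 - α) := by linarith
    _ = (α * (w * t * u) - 1) / (1 - α) - -w * u := by ring

/-- Scalar biconjugate identity (case `α ≠ 1`): on the dual interval
`[−a^{−α}, −b^{−α}]`, the function `θ ↦ g_α(θ) − θ·u` attains its minimum at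
`θ = −u^{−α}`, with minimum value `f_α(u)`. -/
theorem scalar_biconjugate_alpha_fairness
    (α a b u : ℝ) (hα : 0 < α) (hα1 : α ≠ 1)
    (ha : 0 < a) (hau : a ≤ u) (hub : u ≤ b) :
    -u ^ (-α) ∈ Set.Icc (-a ^ (-α)) (-b ^ (-α)) ∧
    gAlpha α (-u ^ (-α)) - (-u ^ (-α)) * u = fAlpha α u ∧
    ∀ θ ∈ Set.Icc (-a ^ (-α)) (-b ^ (-α)), fAlpha α u ≤ gAlpha α θ - θ * u := by
  have hu : 0 < u := ha.trans_le hau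
  have hb : 0 < b := hu.trans_le hub
  refine ⟨⟨?_, ?_⟩, ?_, fun θ hθ => ?_⟩
  · exact neg_le_neg (Real.rpow_le_rpow_of_nonpos ha hau (by linarith))
  · exact neg_le_neg (Real.rpow_le_rpow_of_nonpos hu hub (by linarith))
  · have hne : 1 - α ≠ 0 := sub_ne_zero.mpr hα1.symm
    have hg : (u ^ (-α)) ^ (1 - 1 / α) = u ^ (1 - α) := by
      rw [← Real.rpow_mul hu.le]
      congr 1
      field_simp
      ring
    have hm : u ^ (-α) * u = u ^ (1 - α) := by
      rw [← Real.rpow_add_one hu.ne', neg_add_eq_sub]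
    unfold fAlpha gAlpha
    rw [neg_neg, hg, neg_mul, hm]
    field_simp
    ring
  · exact fAlpha_le_gAlpha_sub hα hα1 hu
      (hθ.2.trans_lt (neg_lt_zero.mpr (Real.rpow_pos_of_pos hb _)))
end

section
/- For every ρ > 0, the function u : (0, ∞) → ℝ given by u(y) = (ρ/y)·(1 − exp(−y/ρ)) is convex on (0, ∞). -/
theorem integral_exp_mul_zero_one {c : ℝ} (hc : c ≠ 0) :
    ∫ t in (0 : ℝ)..1, Real.exp (c * t) = c⁻¹ * (Real.exp c - 1) := by
  rw [intervalIntegral.integral_comp_mul_left _ hc, integral_exp]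
  simp

theorem convexOn_integral_exp_mul :
    ConvexOn ℝ Set.univ (fun c : ℝ => ∫ t in (0 : ℝ)..1, Real.exp (c * t)) := by
  have hint (c : ℝ) : IntervalIntegrable (fun t => Real.exp (c * t)) MeasureTheory.volume 0 1 :=
    (by fun_prop : Continuous fun t => Real.exp (c * t)).intervalIntegrable 0 1
  refine ⟨convex_univ, fun x _ y _ a b ha hb hab => ?_⟩
  simp only [smul_eq_mul]
  rw [← intervalIntegral.integral_const_mul, ← intervalIntegral.integral_const_mul,
    ← intervalIntegral.integral_add ((hint x).const_mul a) ((hint y).const_mul b)]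
  refine intervalIntegral.integral_mono_on zero_le_one (hint _)
    (((hint x).const_mul a).add ((hint y).const_mul b)) fun t _ => ?_
  have h := convexOn_exp.2 (Set.mem_univ (x * t)) (Set.mem_univ (y * t)) ha hb hab
  simp only [smul_eq_mul] at h
  have hlin : (a * x + b * y) * t = a * (x * t) + b * (y * t) := by ring
  rw [hlin]
  exact h

/-- The empty-buffer probability `u(y) = (ρ/y)·(1 − exp(−y/ρ))` is convex on `(0, ∞)`. -/
theorem empty_buffer_probability_convex (ρ : ℝ) (hρ : 0 < ρ) :
    ConvexOn ℝ (Set.Ioi (0 : ℝ)) (fun y => ρ / y * (1 - Real.exp (-y / ρ))) := by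
  have h := (convexOn_integral_exp_mul.comp_linearMap (LinearMap.mulLeft ℝ (-ρ⁻¹))).subset
    (Set.subset_univ _) (convex_Ioi (0 : ℝ))
  refine h.congr fun y hy => ?_
  have hy0 : y ≠ 0 := ne_of_gt hy
  have hc : -ρ⁻¹ * y = -y / ρ := by ring
  simp only [Function.comp_apply, LinearMap.mulLeft_apply, hc]
  rw [integral_exp_mul_zero_one (div_ne_zero (neg_ne_zero.2 hy0) hρ.ne'), inv_div, div_neg]
  ring
end
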